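/- There exists a universal constant C > 0 such that the following holds. Let N ≥ 1, let x_1,…,x_N ∈ ℝ² be distinct, set r(x_i) = (1/2) min_{j≠i} |x_j − x_i|, let λ > 0 satisfy λ ≤ r(x_i)/4 for every i, and let y_1,…,y_N ∈ ℝ² satisfy |y_i − x_i| ≤ r(x_i)/2 for every i. Then F_λ(X_N, Y_N) ≤ − Σ_{i=1}^N g_λ(x_i − y_i) + C Σ_{i=1}^N |x_i − y_i|² / r(x_i)². -/

import Mathlib

open MeasureTheory Real
open scoped ENNReal NNReal BigOperators Classical

noncomputable section

/-- The plane `ℝ²`. -/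
abbrev E2 := EuclideanSpace ℝ (Fin 2)

/-- The logarithmic Coulomb kernel `g(x) = -log |x|`. -/
def gfun (x : E2) : ℝ := -Real.log ‖x‖

/-- The uniform probability measure on the closed ball `B(z, lam)` (smeared charge). -/
def udisc (z : E2) (lam : ℝ) : MeasureTheory.Measure E2 :=
  (MeasureTheory.volume (Metric.closedBall z lam))⁻¹ •
    MeasureTheory.volume.restrict (Metric.closedBall z lam)

/-- The smeared interaction `g_lam(z) = ∬ g(x-y) dδ_0^{(lam)}(x) dδ_z^{(lam)}(y)`. -/
def gsm (lam : ℝ) (z : E2) : ℝ :=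
  ∫ x, (∫ y, gfun (x - y) ∂(udisc z lam)) ∂(udisc 0 lam)

/-- `κ = g_1(0)`. -/
def kappa : ℝ := gsm 1 0

/-- The (renormalized) energy `F_lam(X_N, Y_N)`. -/
def Flam (N : ℕ) (lam : ℝ) (X Y : Fin N → E2) : ℝ :=
  (1/2) * (∑ i : Fin N, ∑ j : Fin N,
      (gsm lam (X i - X j) + gsm lam (Y i - Y j) - 2 * gsm lam (X i - Y j)))
    - N * (-Real.log lam + kappa)

/-- The box `Λ = [0, √N]²`. -/
def LamBox (N : ℕ) : Set E2 := {x | ∀ i, x i ∈ Set.Icc (0:ℝ) (Real.sqrt N)}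

/-- The configuration space `Λ^N × Λ^N`. -/
def confSet (N : ℕ) : Set ((Fin N → E2) × (Fin N → E2)) :=
  {P | (∀ i, P.1 i ∈ LamBox N) ∧ (∀ i, P.2 i ∈ LamBox N)}

/-- The partition function `Z_{N,β}^{lam}`. -/
def Zpart (N : ℕ) (β lam : ℝ) : ℝ :=
  ∫ P in confSet N, Real.exp (-β * Flam N lam P.1 P.2)

/-- `g_1` evaluated at (any) point of norm `r` (it is radial). -/
def g1rad (r : ℝ) : ℝ := gsm 1 (EuclideanSpace.single (0 : Fin 2) r)

/-- The constant `𝒵_β`. -/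
def Zbeta (β : ℝ) : ℝ :=
  if β = 2 then 2 * Real.pi
  else 2 * Real.pi * ∫ r in Set.Ioi (0:ℝ), Real.exp (β * g1rad r) * r

/-- The error rate `ω_lam` (with `M₀ = 36`). -/
def omegaL (β lam : ℝ) : ℝ :=
  if β = 2 then |Real.log lam| ^ (-(1:ℝ)/(5+36))
  else if β < 4 then lam ^ ((2*(β-2))/(12-β+36))
  else if β = 4 then (lam * |Real.log lam|) ^ ((1:ℝ)/(2+36))
  else lam ^ ((1:ℝ)/(2+36))

/-- Half the minimal distance from `x_i` to the other points of the configuration. -/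
def rmin {N : ℕ} (X : Fin N → E2) (i : Fin N) : ℝ :=
  (1/2) * ⨅ j : {j : Fin N // j ≠ i}, dist (X j.1) (X i)

/-- The integral over a disc of a function all of whose circle averages about the centre agree. -/
lemma setIntegral_closedBall_of_circleAverage {E : Type*} [NormedAddCommGroup E]
    [NormedSpace ℝ E] [CompleteSpace E] {f : ℂ → E} {c : ℂ} {R : ℝ} {A : E} (hR : 0 ≤ R)
    (hf : IntegrableOn f (Metric.closedBall c R))
    (h : ∀ r, 0 < r → r < R → Real.circleAverage f c r = A) :
    ∫ z in Metric.closedBall c R, f z = (π * R ^ 2) • A := by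
  set F : ℂ → E := fun z => (Metric.closedBall c R).indicator f (z + c) with hF
  have hball : MeasurableSet (Metric.closedBall c R) := Metric.isClosed_closedBall.measurableSet
  have hFi : Integrable F := by
    have := (integrable_indicator_iff hball).2 hf
    exact this.comp_add_right c
  have e1 : ∫ z in Metric.closedBall c R, f z = ∫ z, F z := by
    rw [← integral_indicator hball]
    exact (integral_add_right_eq_self (fun z => (Metric.closedBall c R).indicator f z) c).symm
  have hsymm : ∀ p : ℝ × ℝ, Complex.polarCoord.symm p
      = Complex.measurableEquivRealProd.symm (polarCoord.symm p) := fun p => rfl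
  have hint : IntegrableOn (fun p : ℝ × ℝ => p.1 • F (Complex.polarCoord.symm p))
      polarCoord.target := by
    have h1 : Integrable (F ∘ Complex.measurableEquivRealProd.symm) :=
      (Complex.volume_preserving_equiv_real_prod.symm).integrable_comp_of_integrable hFi
    have h2 := (integrableOn_image_iff_integrableOn_abs_det_fderiv_smul volume
      (s := polarCoord.target) (f := polarCoord.symm) (f' := fderivPolarCoordSymm)
      polarCoord.open_target.measurableSet
      (fun p _ => (hasFDerivAt_polarCoord_symm p).hasFDerivWithinAt) polarCoord.symm.injOn
      (F ∘ Complex.measurableEquivRealProd.symm)).1 h1.integrableOn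
    refine h2.congr_fun (fun p hp => ?_) polarCoord.open_target.measurableSet
    simp only [det_fderivPolarCoordSymm, Function.comp_apply]
    rw [abs_of_pos hp.1, hsymm]
  have hpol : ∀ r θ : ℝ, Complex.polarCoord.symm (r, θ) + c = circleMap c r θ := by
    intro r θ
    rw [Complex.polarCoord_symm_apply, circleMap, Complex.exp_mul_I]
    push_cast
    ring
  rw [e1, ← Complex.integral_comp_polarCoord_symm]
  have htgt : polarCoord.target = Set.Ioi (0 : ℝ) ×ˢ Set.Ioo (-π) π := rfl
  rw [htgt] at hint ⊢
  rw [Measure.volume_eq_prod] at hint ⊢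
  rw [setIntegral_prod _ hint]
  have hin : ∀ r ∈ Set.Ioi (0 : ℝ), r ≠ R → (∫ θ in Set.Ioo (-π) π,
      r • F (Complex.polarCoord.symm (r, θ)))
      = (Set.Ioc 0 R).indicator (fun r => r • (2 * π) • A) r := by
    intro r hr hne
    have hr0 : 0 < r := hr
    by_cases hrR : r < R
    · rw [Set.indicator_of_mem (Set.mem_Ioc.2 ⟨hr0, hrR.le⟩), integral_smul]
      congr 1
      have : ∀ θ : ℝ, F (Complex.polarCoord.symm (r, θ)) = f (circleMap c r θ) := by
        intro θ
        simp only [hF]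
        rw [hpol, Set.indicator_of_mem]
        exact Metric.closedBall_subset_closedBall hrR.le (circleMap_mem_closedBall c hr0.le θ)
      simp only [this]
      have hA := h r hr0 hrR
      rw [Real.circleAverage_def] at hA
      rw [← hA, smul_smul, mul_inv_cancel₀ (by positivity), one_smul, ← integral_Ioc_eq_integral_Ioo,
        ← intervalIntegral.integral_of_le (by linarith [pi_pos])]
      have hper : Function.Periodic (fun θ => f (circleMap c r θ)) (2 * π) := by
        intro θ
        simp only [(periodic_circleMap c r) θ]
      have := hper.intervalIntegral_add_eq (-π) 0
      rw [show -π + 2 * π = π by ring, zero_add] at this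
      exact this
    · have hRr : R < r := lt_of_le_of_ne (not_lt.1 hrR) (Ne.symm hne)
      rw [Set.indicator_of_notMem (by simp [hRr])]
      have : ∀ θ : ℝ, F (Complex.polarCoord.symm (r, θ)) = 0 := by
        intro θ
        simp only [hF]
        rw [hpol, Set.indicator_of_notMem]
        simp [circleMap, abs_of_pos hr0, hRr]
      simp only [this, smul_zero, integral_zero]
  have hae : ∀ᵐ r ∂(volume.restrict (Set.Ioi (0 : ℝ))), (∫ θ in Set.Ioo (-π) π,
      r • F (Complex.polarCoord.symm (r, θ)))
      = (Set.Ioc 0 R).indicator (fun r => r • (2 * π) • A) r := by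
    filter_upwards [self_mem_ae_restrict measurableSet_Ioi,
      ae_restrict_of_ae (s := Set.Ioi (0:ℝ)) (Measure.ae_ne volume R)] with r hr hne using hin r hr hne
  rw [integral_congr_ae hae, setIntegral_indicator measurableSet_Ioc,
    Set.inter_eq_right.2 Set.Ioc_subset_Ioi_self, integral_smul_const,
    ← intervalIntegral.integral_of_le hR, integral_id, smul_smul]
  congr 1
  ring

lemma integrableOn_log_norm_ball (r : ℝ) :
    IntegrableOn (fun z : ℂ => Real.log ‖z‖) (Metric.ball 0 r) := by
  rw [integrableOn_fun_norm_addHaar volume (f := Real.log), Complex.finrank_real_complex]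
  simp only [Nat.add_one_sub_one, pow_one, smul_eq_mul]
  exact (Real.continuous_mul_log.integrableOn_Icc (a := 0) (b := r)).mono_set Set.Ioo_subset_Icc_self

lemma integrableOn_log_norm_sub_closedBall (a c : ℂ) (R : ℝ) :
    IntegrableOn (fun z : ℂ => Real.log ‖z - a‖) (Metric.closedBall c R) := by
  set r := R + ‖c - a‖ + 1
  have h := (integrable_indicator_iff Metric.isOpen_ball.measurableSet).2
    (integrableOn_log_norm_ball r)
  have h2 := (h.comp_sub_right a).integrableOn (s := Metric.closedBall c R)
  refine h2.congr_fun (fun z hz => ?_) Metric.isClosed_closedBall.measurableSet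
  beta_reduce
  rw [Set.indicator_of_mem]
  rw [mem_ball_zero_iff]
  have h3 : ‖z - c‖ ≤ R := by simpa [dist_eq_norm] using hz
  calc ‖z - a‖ = ‖(z - c) + (c - a)‖ := by ring_nf
    _ ≤ ‖z - c‖ + ‖c - a‖ := norm_add_le _ _
    _ < r := by simp only [r]; linarith

lemma setIntegral_log_norm_sub {a c : ℂ} {R : ℝ} (hR : 0 ≤ R) (h : R ≤ ‖c - a‖) :
    ∫ z in Metric.closedBall c R, Real.log ‖z - a‖ = π * R ^ 2 * Real.log ‖c - a‖ := by
  refine setIntegral_closedBall_of_circleAverage hR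
    (integrableOn_log_norm_sub_closedBall a c R) (fun r h0 hr => ?_)
  rw [circleAverage_log_norm_sub_const_eq_log_radius_add_posLog h0.ne']
  have hpos : 0 < ‖c - a‖ := by linarith
  rw [Real.posLog_eq_log, Real.log_mul (by positivity) hpos.ne', Real.log_inv]
  · ring
  · rw [abs_of_pos (by positivity), inv_mul_eq_div, one_le_div h0]
    linarith

lemma setIntegral_inv_sub_sq {a c : ℂ} {R : ℝ} (hR : 0 ≤ R) (h : R < ‖c - a‖) :
    ∫ z in Metric.closedBall c R, ((z - a) ^ 2)⁻¹ = (π * R ^ 2 : ℝ) * ((c - a) ^ 2)⁻¹ := by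
  have hne : ∀ z ∈ Metric.closedBall c R, z - a ≠ 0 := by
    intro z hz h0
    rw [sub_eq_zero.1 h0, mem_closedBall_iff_norm, norm_sub_rev] at hz
    linarith
  have hd : ∀ z ∈ Metric.closedBall c R,
      DifferentiableAt ℂ (fun z : ℂ => ((z - a) ^ 2)⁻¹) z := fun z hz =>
    DifferentiableAt.inv (by fun_prop) (pow_ne_zero 2 (hne z hz))
  have hc : ContinuousOn (fun z : ℂ => ((z - a) ^ 2)⁻¹) (Metric.closedBall c R) :=
    fun z hz => (hd z hz).continuousAt.continuousWithinAt
  have := setIntegral_closedBall_of_circleAverage (A := ((c - a) ^ 2)⁻¹) hR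
    (hc.integrableOn_compact (isCompact_closedBall c R)) (fun r h0 hr => ?_)
  · rw [this, Complex.real_smul]
  · have hsub : Metric.closedBall c |r| ⊆ Metric.closedBall c R := by
      rw [abs_of_pos h0]; exact Metric.closedBall_subset_closedBall hr.le
    exact circleAverage_of_differentiable_on_off_countable Set.countable_empty
      (hc.mono hsub) (fun z hz => hd z (hsub (Metric.ball_subset_closedBall hz.1)))

/-- The isometric identification of the plane with `ℂ`. -/
def planeIso : E2 ≃ₗᵢ[ℝ] ℂ := Complex.orthonormalBasisOneI.repr.symm

lemma integral_udisc (f : E2 → ℝ) (z : E2) {lam : ℝ} (hlam : 0 < lam) :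
    ∫ x, f x ∂(udisc z lam)
      = (π * lam ^ 2)⁻¹ * ∫ w in Metric.closedBall (planeIso z) lam, f (planeIso.symm w) := by
  have hvol : (volume (Metric.closedBall z lam))⁻¹.toReal = (π * lam ^ 2)⁻¹ := by
    rw [EuclideanSpace.volume_closedBall_fin_two, ENNReal.toReal_inv, ENNReal.toReal_mul,
      ENNReal.toReal_pow, ENNReal.toReal_ofReal hlam.le]
    simp [mul_comm, pi_pos.le]
  rw [udisc, integral_smul_measure, hvol, smul_eq_mul]
  congr 1
  have := planeIso.measurePreserving.setIntegral_preimage_emb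
    planeIso.toHomeomorph.measurableEmbedding (fun w => f (planeIso.symm w))
    (Metric.closedBall (planeIso z) lam)
  rw [← this]
  simp

lemma gsm_eq_integral (z : E2) {lam : ℝ} (hlam : 0 < lam) :
    gsm lam z = (π * lam ^ 2)⁻¹ * ∫ x in Metric.closedBall (0 : ℂ) lam,
      (π * lam ^ 2)⁻¹ * ∫ y in Metric.closedBall (planeIso z) lam, -Real.log ‖x - y‖ := by
  rw [gsm, integral_udisc _ _ hlam, map_zero]
  congr 1
  refine integral_congr_ae (.of_forall fun x => ?_)
  beta_reduce
  rw [integral_udisc _ _ hlam]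
  congr 1
  refine integral_congr_ae (.of_forall fun y => ?_)
  simp only [gfun]
  rw [← map_sub, LinearIsometryEquiv.norm_map]

/-- Newton's theorem for two disjoint discs. -/
lemma gsm_eq_neg_log {z : E2} {lam : ℝ} (hlam : 0 < lam) (hz : 2 * lam ≤ ‖z‖) :
    gsm lam z = -Real.log ‖z‖ := by
  rw [gsm_eq_integral z hlam]
  have hn : ‖planeIso z‖ = ‖z‖ := planeIso.norm_map z
  have hp : π * lam ^ 2 ≠ 0 := by positivity
  have h1 : ∀ x ∈ Metric.closedBall (0 : ℂ) lam,
      (π * lam ^ 2)⁻¹ * ∫ y in Metric.closedBall (planeIso z) lam, -Real.log ‖x - y‖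
        = -Real.log ‖x - planeIso z‖ := by
    intro x hx
    have hx' : ‖x‖ ≤ lam := by simpa using hx
    have : lam ≤ ‖planeIso z - x‖ := by
      have := norm_sub_norm_le (planeIso z) x
      linarith
    rw [integral_neg]
    simp only [norm_sub_rev x]
    rw [setIntegral_log_norm_sub hlam.le this]
    field_simp
  rw [setIntegral_congr_fun Metric.isClosed_closedBall.measurableSet h1, integral_neg,
    setIntegral_log_norm_sub hlam.le (by simp; linarith), zero_sub, norm_neg, hn]
  field_simp

lemma integrable_log_norm_sub_prod (c d : ℂ) (R : ℝ) :
    Integrable (fun p : ℂ × ℂ => Real.log ‖p.1 - p.2‖)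
      ((volume.restrict (Metric.closedBall c R)).prod (volume.restrict (Metric.closedBall d R))) := by
  have hb : ∀ a : ℂ, MeasurableSet (Metric.closedBall a R) :=
    fun a => Metric.isClosed_closedBall.measurableSet
  set r := R + R + ‖c - d‖ + 1
  have h := (integrable_indicator_iff Metric.isOpen_ball.measurableSet).2
    (integrableOn_log_norm_ball r)
  have h1 : Integrable ((Metric.closedBall d R).indicator (fun _ => (1 : ℝ))) :=
    (integrable_indicator_iff (hb d)).2
      (integrableOn_const (isCompact_closedBall d R).measure_lt_top.ne)
  have h2 := (h1.convolution_integrand (ContinuousLinearMap.mul ℝ ℝ) h)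
  rw [Measure.prod_restrict]
  refine (h2.integrableOn (s := Metric.closedBall c R ×ˢ Metric.closedBall d R)).congr_fun
    (fun p hp => ?_) ((hb c).prod (hb d))
  have h3 : ‖p.1 - c‖ ≤ R := by simpa [dist_eq_norm] using hp.1
  have h4 : ‖p.2 - d‖ ≤ R := by simpa [dist_eq_norm] using hp.2
  simp only [ContinuousLinearMap.mul_apply']
  rw [Set.indicator_of_mem hp.2, one_mul, Set.indicator_of_mem]
  rw [mem_ball_zero_iff]
  calc ‖p.1 - p.2‖ = ‖(p.1 - c) - (p.2 - d) + (c - d)‖ := by ring_nf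
    _ ≤ ‖p.1 - c‖ + ‖p.2 - d‖ + ‖c - d‖ := (norm_add_le _ _).trans (by gcongr; exact norm_sub_le _ _)
    _ < r := by simp only [r]; linarith

lemma setIntegral_closedBall_zero_smul (f : ℂ → ℝ) {lam : ℝ} (hlam : 0 < lam) :
    ∫ x in Metric.closedBall (0 : ℂ) lam, f x
      = lam ^ 2 * ∫ x in Metric.closedBall (0 : ℂ) 1, f (lam • x) := by
  have h := Measure.setIntegral_comp_smul_of_pos (volume : Measure ℂ) f
    (Metric.closedBall (0 : ℂ) 1) hlam
  rw [h, smul_closedBall _ _ zero_le_one, Complex.finrank_real_complex]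
  simp [abs_of_pos hlam]
  field_simp

lemma gsm_zero {lam : ℝ} (hlam : 0 < lam) : gsm lam 0 = -Real.log lam + kappa := by
  rw [kappa, gsm_eq_integral _ hlam, gsm_eq_integral _ one_pos, map_zero]
  have hb : MeasurableSet (Metric.closedBall (0 : ℂ) 1) := Metric.isClosed_closedBall.measurableSet
  have : IsFiniteMeasure (volume.restrict (Metric.closedBall (0 : ℂ) 1)) :=
    isFiniteMeasure_restrict.2 (isCompact_closedBall (0 : ℂ) 1).measure_lt_top.ne
  have hint := integrable_log_norm_sub_prod 0 0 1
  have hvol : volume.real (Metric.closedBall (0 : ℂ) 1) = π := by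
    rw [Measure.real, Complex.volume_closedBall]; simp
  have hin : ∀ᵐ x ∂(volume.restrict (Metric.closedBall (0 : ℂ) 1)),
      (π * lam ^ 2)⁻¹ * ∫ y in Metric.closedBall (0 : ℂ) lam, -Real.log ‖lam • x - y‖
      = -Real.log lam + (π * 1 ^ 2)⁻¹ * ∫ y in Metric.closedBall (0 : ℂ) 1, -Real.log ‖x - y‖ := by
    filter_upwards [hint.prod_right_ae] with x hx
    have hx' : Integrable (fun y => -Real.log ‖x - y‖)
        (volume.restrict (Metric.closedBall (0 : ℂ) 1)) := hx.neg
    have : ∀ᵐ y ∂(volume.restrict (Metric.closedBall (0 : ℂ) 1)),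
        -Real.log ‖lam • x - lam • y‖ = -Real.log lam + -Real.log ‖x - y‖ := by
      filter_upwards [ae_restrict_of_ae (Measure.ae_ne volume x)] with y hy
      rw [← smul_sub, norm_smul, Real.log_mul, Real.norm_of_nonneg hlam.le]
      · ring
      · simpa using hlam.ne'
      · rw [norm_ne_zero_iff, sub_ne_zero]; exact hy.symm
    rw [setIntegral_closedBall_zero_smul _ hlam, integral_congr_ae this,
      integral_add (integrable_const _) hx', integral_const, measureReal_restrict_apply_univ,
      hvol, smul_eq_mul]
    field_simp
  have hout : Integrable (fun x => (π * 1 ^ 2)⁻¹ *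
      ∫ y in Metric.closedBall (0 : ℂ) 1, -Real.log ‖x - y‖)
      (volume.restrict (Metric.closedBall (0 : ℂ) 1)) :=
    hint.neg.integral_prod_left.const_mul _
  rw [setIntegral_closedBall_zero_smul _ hlam, integral_congr_ae hin,
    integral_add (integrable_const _) hout, integral_const, measureReal_restrict_apply_univ, hvol,
    smul_eq_mul]
  field_simp

section Gram

variable {α Ω : Type*} [MeasurableSpace α] [MeasurableSpace Ω] {μ : Measure α} {ν : Measure Ω}

lemma integrable_mul_of_integrable_norm_sq {f g : Ω → ℂ} (hf : AEStronglyMeasurable f ν)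
    (hg : AEStronglyMeasurable g ν) (hf2 : Integrable (fun ω => ‖f ω‖ ^ 2) ν)
    (hg2 : Integrable (fun ω => ‖g ω‖ ^ 2) ν) : Integrable (fun ω => f ω * g ω) ν := by
  refine ((hf2.add hg2).const_mul (1 / 2)).mono' (hf.mul hg) (.of_forall fun ω => ?_)
  simp only [Pi.add_apply, norm_mul]
  nlinarith [sq_nonneg (‖f ω‖ - ‖g ω‖)]

lemma integral_norm_mul_le {f g : Ω → ℂ} (hf2 : Integrable (fun ω => ‖f ω‖ ^ 2) ν)
    (hg2 : Integrable (fun ω => ‖g ω‖ ^ 2) ν) :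
    ∫ ω, ‖f ω * g ω‖ ∂ν ≤ 1 / 2 * (∫ ω, ‖f ω‖ ^ 2 ∂ν + ∫ ω, ‖g ω‖ ^ 2 ∂ν) := by
  rw [← integral_add hf2 hg2, ← integral_const_mul]
  refine integral_mono_of_nonneg (.of_forall fun ω => norm_nonneg _)
    ((hf2.add hg2).const_mul (1 / 2)) (.of_forall fun ω => ?_)
  simp only [norm_mul]
  nlinarith [sq_nonneg (‖f ω‖ - ‖g ω‖)]

variable [SFinite μ] [SFinite ν]

/-- Fubini for the product of two superpositions of square-integrable features. -/
lemma integrable_and_integral_superposition_mul {φ ψ : α → Ω → ℂ}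
    (hφ : Measurable (Function.uncurry φ)) (hψ : Measurable (Function.uncurry ψ)) {M : ℝ}
    (hφ2 : ∀ a, Integrable (fun ω => ‖φ a ω‖ ^ 2) ν) (hφM : ∀ a, ∫ ω, ‖φ a ω‖ ^ 2 ∂ν ≤ M)
    (hψ2 : ∀ a, Integrable (fun ω => ‖ψ a ω‖ ^ 2) ν) (hψM : ∀ a, ∫ ω, ‖ψ a ω‖ ^ 2 ∂ν ≤ M)
    {f h : α → ℂ} (hf : Integrable f μ) (hh : Integrable h μ) :
    Integrable (fun ω => (∫ a, f a * φ a ω ∂μ) * ∫ b, h b * ψ b ω ∂μ) ν ∧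
    ∫ ω, (∫ a, f a * φ a ω ∂μ) * (∫ b, h b * ψ b ω ∂μ) ∂ν
      = ∫ p, f p.1 * h p.2 * (∫ ω, φ p.1 ω * ψ p.2 ω ∂ν) ∂(μ.prod μ) := by
  have hφa : ∀ a, Measurable (φ a) := fun a => hφ.comp measurable_prodMk_left
  have hψa : ∀ a, Measurable (ψ a) := fun a => hψ.comp measurable_prodMk_left
  have hmul : ∀ a b, Integrable (fun ω => φ a ω * ψ b ω) ν := fun a b =>
    integrable_mul_of_integrable_norm_sq (hφa a).aestronglyMeasurable
      (hψa b).aestronglyMeasurable (hφ2 a) (hψ2 b)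
  set G : (α × α) × Ω → ℂ := fun q => f q.1.1 * h q.1.2 * (φ q.1.1 q.2 * ψ q.1.2 q.2) with hG
  have hfh : Integrable (fun p : α × α => f p.1 * h p.2) (μ.prod μ) := hf.mul_prod hh
  have m1 : Measurable (fun q : (α × α) × Ω => φ q.1.1 q.2) :=
    hφ.comp (f := fun q : (α × α) × Ω => (q.1.1, q.2)) (by fun_prop)
  have m2 : Measurable (fun q : (α × α) × Ω => ψ q.1.2 q.2) :=
    hψ.comp (f := fun q : (α × α) × Ω => (q.1.2, q.2)) (by fun_prop)
  have hGm : AEStronglyMeasurable G ((μ.prod μ).prod ν) :=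
    hfh.aestronglyMeasurable.comp_fst.mul (m1.mul m2).aestronglyMeasurable
  have hGi : Integrable G ((μ.prod μ).prod ν) := by
    rw [integrable_prod_iff hGm]
    refine ⟨.of_forall fun p => (hmul p.1 p.2).const_mul (f p.1 * h p.2), ?_⟩
    refine (hfh.norm.mul_const M).mono' hGm.norm.integral_prod_right' (.of_forall fun p => ?_)
    rw [Real.norm_of_nonneg (integral_nonneg fun _ => norm_nonneg _)]
    simp only [hG]
    have : ∀ ω, ‖f p.1 * h p.2 * (φ p.1 ω * ψ p.2 ω)‖
        = ‖f p.1 * h p.2‖ * ‖φ p.1 ω * ψ p.2 ω‖ := fun ω => norm_mul _ _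
    simp only [this]
    rw [integral_const_mul]
    gcongr
    refine (integral_norm_mul_le (hφ2 _) (hψ2 _)).trans ?_
    linarith [hφM p.1, hψM p.2]
  have hinner : ∀ ω, ∫ p, G (p, ω) ∂(μ.prod μ)
      = (∫ a, f a * φ a ω ∂μ) * ∫ b, h b * ψ b ω ∂μ := by
    intro ω
    rw [← integral_prod_mul]
    congr 1
    ext p
    simp only [hG]
    ring
  constructor
  · have := hGi.integral_prod_right
    simpa only [hinner] using this
  · simp only [← hinner]
    rw [← integral_prod_symm G hGi, integral_prod G hGi]
    simp only [hG, integral_const_mul]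

end Gram

section GaussianFeature

open ComplexConjugate

lemma integral_gaussian_plane {b : ℝ} (hb : 0 < b) :
    ∫ v : ℂ, Real.exp (-b * ‖v‖ ^ 2) = π / b := by
  rw [GaussianFourier.integral_rexp_neg_mul_sq_norm hb, Complex.finrank_real_complex]
  simp

lemma integral_norm_sq_mul_gaussian_plane {b : ℝ} (hb : 0 < b) :
    ∫ v : ℂ, ‖v‖ ^ 2 * Real.exp (-b * ‖v‖ ^ 2) = π / b ^ 2 := by
  have := Complex.integral_rpow_mul_exp_neg_mul_rpow (p := 2) (q := 2) (b := b)
    (by norm_num) (by norm_num) hb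
  norm_num at this
  simpa [neg_mul, div_eq_mul_inv] using this

lemma integrable_gaussian_plane {b : ℝ} (hb : 0 < b) :
    Integrable (fun v : ℂ => Real.exp (-b * ‖v‖ ^ 2)) := by
  refine not_imp_comm.1 integral_undef ?_
  rw [integral_gaussian_plane hb]
  positivity

lemma integrable_norm_sq_mul_gaussian_plane {b : ℝ} (hb : 0 < b) :
    Integrable (fun v : ℂ => ‖v‖ ^ 2 * Real.exp (-b * ‖v‖ ^ 2)) := by
  refine not_imp_comm.1 integral_undef ?_
  rw [integral_norm_sq_mul_gaussian_plane hb]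
  positivity

/-- A Gaussian-weighted function odd under multiplication by a unit complex number has
vanishing integral. -/
lemma integral_eq_zero_of_rotate {F : ℂ → ℂ} (a : Circle) (hF : ∀ v, F (a * v) = -F v) :
    ∫ v, F v = 0 := by
  have h1 : ∫ v, F (rotation a v) = ∫ v, F v :=
    (rotation a).measurePreserving.integral_comp (rotation a).toHomeomorph.measurableEmbedding F
  simp only [rotation_apply, hF, integral_neg] at h1
  have h2 : (2 : ℂ) * ∫ v, F v = 0 := by linear_combination -h1
  simpa using h2

lemma integral_mul_gaussian_plane (b : ℝ) :
    ∫ v : ℂ, v * (Real.exp (-b * ‖v‖ ^ 2) : ℂ) = 0 :=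
  integral_eq_zero_of_rotate (-1) (fun v => by simp)

lemma integral_conj_mul_gaussian_plane (b : ℝ) :
    ∫ v : ℂ, conj v * (Real.exp (-b * ‖v‖ ^ 2) : ℂ) = 0 :=
  integral_eq_zero_of_rotate (-1) (fun v => by simp)

lemma integral_conj_sq_mul_gaussian_plane (b : ℝ) :
    ∫ v : ℂ, conj v ^ 2 * (Real.exp (-b * ‖v‖ ^ 2) : ℂ) = 0 := by
  refine integral_eq_zero_of_rotate ⟨Complex.I, by simp [Submonoid.unitSphere]⟩ (fun v => ?_)
  simp [mul_pow]

lemma integrable_mul_gaussian_plane {b : ℝ} (hb : 0 < b) {g : ℂ → ℂ} (hg : Continuous g)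
    (hle : ∀ v, ‖g v‖ ≤ 1 + ‖v‖ ^ 2) :
    Integrable (fun v : ℂ => g v * (Real.exp (-b * ‖v‖ ^ 2) : ℂ)) := by
  refine ((integrable_gaussian_plane hb).add (integrable_norm_sq_mul_gaussian_plane hb)).mono'
    (by fun_prop) (.of_forall fun v => ?_)
  rw [norm_mul, Complex.norm_real, Real.norm_of_nonneg (Real.exp_nonneg _), Pi.add_apply,
    ← one_add_mul]
  gcongr
  exact hle v

/-- The Gaussian feature of a point `z`, indexed by a scale and a centre. -/
def gaussFeature (z : ℂ) (ω : ℝ × ℂ) : ℂ :=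
  ((ω.1 * Real.exp (-2 * ω.1 * ‖z - ω.2‖ ^ 2) : ℝ) : ℂ) * conj (z - ω.2)

lemma measurable_gaussFeature : Measurable (Function.uncurry gaussFeature) := by
  unfold gaussFeature Function.uncurry
  fun_prop

lemma norm_gaussFeature_sq (z u : ℂ) (s : ℝ) :
    ‖gaussFeature z (s, u)‖ ^ 2 = s ^ 2 * (‖z - u‖ ^ 2 * Real.exp (-(4 * s) * ‖z - u‖ ^ 2)) := by
  rw [gaussFeature, norm_mul, RCLike.norm_conj, Complex.norm_real, mul_pow, norm_mul, mul_pow,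
    Real.norm_eq_abs, sq_abs, Real.norm_of_nonneg (Real.exp_nonneg _), ← Real.exp_nat_mul]
  push_cast
  ring_nf

lemma gaussian_mul_gaussian_eq (z w v : ℂ) (s : ℝ) :
    Real.exp (-2 * s * ‖z - ((z + w) / 2 - v)‖ ^ 2) * Real.exp (-2 * s * ‖w - ((z + w) / 2 - v)‖ ^ 2)
      = Real.exp (-s * ‖z - w‖ ^ 2) * Real.exp (-(4 * s) * ‖v‖ ^ 2) := by
  rw [← Real.exp_add, ← Real.exp_add]
  congr 1
  have h := parallelogram_law_with_norm ℝ ((z - w) / 2) v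
  have e1 : z - ((z + w) / 2 - v) = (z - w) / 2 + v := by ring
  have e2 : ‖w - ((z + w) / 2 - v)‖ = ‖(z - w) / 2 - v‖ := by
    rw [← norm_neg]; congr 1; ring
  have e3 : ‖(z - w) / 2‖ = ‖z - w‖ / 2 := by simp
  rw [e1, e2]
  rw [e3] at h
  linear_combination -2 * s * h

lemma integral_gaussFeature_mul (z w : ℂ) {s : ℝ} (hs : 0 < s) :
    ∫ u, gaussFeature z (s, u) * gaussFeature w (s, u)
      = -((π / 16 : ℝ) : ℂ) * conj (z - w) ^ 2 * ((s * Real.exp (-s * ‖z - w‖ ^ 2) : ℝ) : ℂ) := by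
  rw [← integral_sub_left_eq_self _ _ ((z + w) / 2)]
  have : ∀ v, gaussFeature z (s, (z + w) / 2 - v) * gaussFeature w (s, (z + w) / 2 - v)
      = (s ^ 2 * Real.exp (-s * ‖z - w‖ ^ 2) : ℝ) *
        (conj v ^ 2 * (Real.exp (-(4 * s) * ‖v‖ ^ 2) : ℂ)
          - conj (z - w) ^ 2 / 4 * (Real.exp (-(4 * s) * ‖v‖ ^ 2) : ℝ)) := by
    intro v
    have h := congrArg (fun r : ℝ => (r : ℂ)) (gaussian_mul_gaussian_eq z w v s)
    simp only [gaussFeature, map_sub, map_add, map_div₀, Complex.conj_ofNat, Complex.ofReal_mul,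
      Complex.ofReal_pow] at h ⊢
    linear_combination (s : ℂ) ^ 2 * (conj z - ((conj z + conj w) / 2 - conj v)) *
      (conj w - ((conj z + conj w) / 2 - conj v)) * h
  simp only [this]
  have hs4 : 0 < 4 * s := by positivity
  rw [integral_const_mul, integral_sub, integral_conj_sq_mul_gaussian_plane, integral_const_mul,
    integral_complex_ofReal, integral_gaussian_plane hs4]
  · push_cast
    have hs0 : (s : ℂ) ≠ 0 := by exact_mod_cast hs.ne'
    field_simp
    ring
  · exact integrable_mul_gaussian_plane hs4 (by fun_prop) (fun v => by simp)
  · exact (integrable_gaussian_plane hs4).ofReal.const_mul _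

lemma integral_gaussFeature_mul_conj (z w : ℂ) {s : ℝ} (hs : 0 < s) :
    ∫ u, gaussFeature z (s, u) * conj (gaussFeature w (s, u))
      = ((π / 16 * ((1 - s * ‖z - w‖ ^ 2) * Real.exp (-s * ‖z - w‖ ^ 2)) : ℝ) : ℂ) := by
  rw [← integral_sub_left_eq_self _ _ ((z + w) / 2)]
  have : ∀ v, gaussFeature z (s, (z + w) / 2 - v) * conj (gaussFeature w (s, (z + w) / 2 - v))
      = (s ^ 2 * Real.exp (-s * ‖z - w‖ ^ 2) : ℝ) *
        (((‖v‖ ^ 2 * Real.exp (-(4 * s) * ‖v‖ ^ 2) : ℝ)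
          - ((‖z - w‖ ^ 2 / 4 * Real.exp (-(4 * s) * ‖v‖ ^ 2) : ℝ) : ℂ))
          + (conj (z - w) / 2 * (v * (Real.exp (-(4 * s) * ‖v‖ ^ 2) : ℂ))
          - (z - w) / 2 * (conj v * (Real.exp (-(4 * s) * ‖v‖ ^ 2) : ℂ)))) := by
    intro v
    have h := congrArg (fun r : ℝ => (r : ℂ)) (gaussian_mul_gaussian_eq z w v s)
    have n1 := Complex.mul_conj' v
    have n2 := Complex.mul_conj' (z - w)
    simp only [gaussFeature, map_sub, map_add, map_div₀, map_mul, Complex.conj_ofNat,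
      Complex.ofReal_mul, Complex.ofReal_pow, Complex.conj_ofReal, Complex.conj_conj,
      Complex.ofReal_div, Complex.ofReal_ofNat] at h n1 n2 ⊢
    rw [← n1, ← n2]
    linear_combination (s : ℂ) ^ 2 * (conj z - ((conj z + conj w) / 2 - conj v)) *
      (w - ((z + w) / 2 - v)) * h
  simp only [this]
  have hs4 : 0 < 4 * s := by positivity
  have i1 : Integrable (fun v : ℂ => ((‖v‖ ^ 2 * Real.exp (-(4 * s) * ‖v‖ ^ 2) : ℝ) : ℂ)) :=
    (integrable_norm_sq_mul_gaussian_plane hs4).ofReal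
  have i2 : Integrable
      (fun v : ℂ => ((‖z - w‖ ^ 2 / 4 * Real.exp (-(4 * s) * ‖v‖ ^ 2) : ℝ) : ℂ)) :=
    ((integrable_gaussian_plane hs4).const_mul (‖z - w‖ ^ 2 / 4)).ofReal
  have hle : ∀ v : ℂ, ‖v‖ ≤ 1 + ‖v‖ ^ 2 := fun v => by nlinarith [sq_nonneg (‖v‖ - 1)]
  have i3 := (integrable_mul_gaussian_plane hs4 (g := fun v => v) (by fun_prop) hle).const_mul (conj (z - w) / 2)
  have i4 := (integrable_mul_gaussian_plane hs4 (g := fun v => conj v) (by fun_prop)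
    (fun v => by simpa using hle v)).const_mul ((z - w) / 2)
  have i12 : Integrable (fun v : ℂ => ((‖v‖ ^ 2 * Real.exp (-(4 * s) * ‖v‖ ^ 2) : ℝ) : ℂ)
      - ((‖z - w‖ ^ 2 / 4 * Real.exp (-(4 * s) * ‖v‖ ^ 2) : ℝ) : ℂ)) := i1.sub i2
  have i34 : Integrable (fun v : ℂ => conj (z - w) / 2 * (v * (Real.exp (-(4 * s) * ‖v‖ ^ 2) : ℂ))
      - (z - w) / 2 * (conj v * (Real.exp (-(4 * s) * ‖v‖ ^ 2) : ℂ))) := i3.sub i4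
  rw [integral_const_mul, integral_add i12 i34, integral_sub i1 i2,
    integral_sub i3 i4, integral_const_mul, integral_const_mul, integral_mul_gaussian_plane,
    integral_conj_mul_gaussian_plane, integral_complex_ofReal, integral_complex_ofReal,
    integral_const_mul, integral_norm_sq_mul_gaussian_plane hs4, integral_gaussian_plane hs4]
  push_cast
  have : (s : ℂ) ≠ 0 := by exact_mod_cast hs.ne'
  field_simp
  ring

end GaussianFeature

section ScaleIntegrals

open ComplexConjugate

lemma setIntegral_mul_exp_neg_mul {S q : ℝ} (hS : 0 ≤ S) (hq : q ≠ 0) :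
    ∫ s in Set.Ioc 0 S, s * Real.exp (-s * q) = (1 - (1 + S * q) * Real.exp (-S * q)) / q ^ 2 := by
  have h : ∀ s ∈ Set.uIcc 0 S,
      HasDerivAt (fun s => -((1 + s * q) * Real.exp (-s * q)) / q ^ 2) (s * Real.exp (-s * q)) s := by
    intro s _
    have h1 : HasDerivAt (fun s : ℝ => 1 + s * q) q s := by
      simpa using ((hasDerivAt_id s).mul_const q).const_add 1
    have h2 : HasDerivAt (fun s : ℝ => -s * q) (-q) s := by
      simpa using (hasDerivAt_id s).neg.mul_const q
    refine ((h1.mul h2.exp).neg.div_const (q ^ 2)).congr_deriv ?_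
    field_simp
    ring
  rw [← intervalIntegral.integral_of_le hS, intervalIntegral.integral_eq_sub_of_hasDerivAt h
    (Continuous.intervalIntegrable (by fun_prop) _ _)]
  simp
  ring

lemma setIntegral_one_sub_mul_exp_neg_mul {S : ℝ} (q : ℝ) (hS : 0 ≤ S) :
    ∫ s in Set.Ioc 0 S, (1 - s * q) * Real.exp (-s * q) = S * Real.exp (-S * q) := by
  have h : ∀ s ∈ Set.uIcc 0 S,
      HasDerivAt (fun s => s * Real.exp (-s * q)) ((1 - s * q) * Real.exp (-s * q)) s := by
    intro s _
    have h2 : HasDerivAt (fun s : ℝ => -s * q) (-q) s := by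
      simpa using (hasDerivAt_id s).neg.mul_const q
    refine ((hasDerivAt_id s).mul h2.exp).congr_deriv ?_
    simp only [id]
    ring
  rw [← intervalIntegral.integral_of_le hS, intervalIntegral.integral_eq_sub_of_hasDerivAt h
    (Continuous.intervalIntegrable (by fun_prop) _ _)]
  simp

/-- Lebesgue measure on scales in `(0, S]` times the plane. -/
def scaleMeasure (S : ℝ) : Measure (ℝ × ℂ) := (volume.restrict (Set.Ioc 0 S)).prod volume

instance (S : ℝ) : SFinite (scaleMeasure S) := by
  unfold scaleMeasure
  infer_instance

lemma integral_norm_gaussFeature_sq (z : ℂ) {s : ℝ} (hs : 0 < s) :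
    Integrable (fun u => ‖gaussFeature z (s, u)‖ ^ 2) ∧
    ∫ u, ‖gaussFeature z (s, u)‖ ^ 2 = π / 16 := by
  have hs4 : 0 < 4 * s := by positivity
  have h := ((integrable_norm_sq_mul_gaussian_plane hs4).const_mul (s ^ 2)).comp_sub_left z
  have h2 := integral_sub_left_eq_self
    (fun v : ℂ => s ^ 2 * (‖v‖ ^ 2 * Real.exp (-(4 * s) * ‖v‖ ^ 2))) volume z
  simp only [norm_gaussFeature_sq]
  refine ⟨h, h2.trans ?_⟩
  rw [integral_const_mul, integral_norm_sq_mul_gaussian_plane hs4]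
  field_simp
  ring

lemma integrable_and_integral_norm_gaussFeature_sq (z : ℂ) {S : ℝ} (hS : 0 ≤ S) :
    Integrable (fun ω => ‖gaussFeature z ω‖ ^ 2) (scaleMeasure S) ∧
    ∫ ω, ‖gaussFeature z ω‖ ^ 2 ∂(scaleMeasure S) = S * (π / 16) := by
  have hm : Measurable (gaussFeature z) := measurable_gaussFeature.comp measurable_prodMk_left
  have hc : ∀ᵐ s ∂(volume.restrict (Set.Ioc 0 S)), ∫ u, ‖gaussFeature z (s, u)‖ ^ 2 = π / 16 :=
    (ae_restrict_iff' measurableSet_Ioc).2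
      (.of_forall fun s hs => (integral_norm_gaussFeature_sq z hs.1).2)
  have hi : Integrable (fun ω => ‖gaussFeature z ω‖ ^ 2) (scaleMeasure S) := by
    rw [scaleMeasure, integrable_prod_iff (hm.norm.pow_const 2).aestronglyMeasurable]
    refine ⟨(ae_restrict_iff' measurableSet_Ioc).2
      (.of_forall fun s hs => (integral_norm_gaussFeature_sq z hs.1).1), ?_⟩
    simp only [norm_pow, norm_norm]
    exact (integrable_const (π / 16)).congr (hc.mono fun s hs => hs.symm)
  refine ⟨hi, ?_⟩
  rw [scaleMeasure] at hi ⊢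
  rw [integral_prod _ hi, integral_congr_ae hc]
  simp [hS]

lemma integrable_gaussFeature_mul (z w : ℂ) {S : ℝ} (hS : 0 ≤ S) :
    Integrable (fun ω => gaussFeature z ω * gaussFeature w ω) (scaleMeasure S) := by
  have hm : ∀ z, Measurable (gaussFeature z) := fun z =>
    measurable_gaussFeature.comp measurable_prodMk_left
  exact integrable_mul_of_integrable_norm_sq (hm z).aestronglyMeasurable (hm w).aestronglyMeasurable
    (integrable_and_integral_norm_gaussFeature_sq z hS).1
    (integrable_and_integral_norm_gaussFeature_sq w hS).1

lemma integrable_gaussFeature_mul_conj (z w : ℂ) {S : ℝ} (hS : 0 ≤ S) :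
    Integrable (fun ω => gaussFeature z ω * conj (gaussFeature w ω)) (scaleMeasure S) := by
  have hm : ∀ z, Measurable (gaussFeature z) := fun z =>
    measurable_gaussFeature.comp measurable_prodMk_left
  exact integrable_mul_of_integrable_norm_sq (hm z).aestronglyMeasurable
    (Complex.continuous_conj.measurable.comp (hm w)).aestronglyMeasurable
    (integrable_and_integral_norm_gaussFeature_sq z hS).1
    (by simpa using (integrable_and_integral_norm_gaussFeature_sq w hS).1)

/-- Gaussian regularization of the kernel `d ↦ 1 / d ^ 2`. -/
def gaussKernel (S : ℝ) (d : ℂ) : ℂ :=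
  ((1 - (1 + S * ‖d‖ ^ 2) * Real.exp (-S * ‖d‖ ^ 2) : ℝ) : ℂ) * (d ^ 2)⁻¹

lemma integral_gaussFeature_mul_eq_gaussKernel (z w : ℂ) {S : ℝ} (hS : 0 ≤ S) :
    ∫ ω, gaussFeature z ω * gaussFeature w ω ∂(scaleMeasure S)
      = -((π / 16 : ℝ) : ℂ) * gaussKernel S (z - w) := by
  have hi := integrable_gaussFeature_mul z w hS
  rw [scaleMeasure] at hi ⊢
  rw [integral_prod _ hi, setIntegral_congr_fun measurableSet_Ioc
    (fun s hs => integral_gaussFeature_mul z w hs.1), integral_const_mul, integral_complex_ofReal]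
  rcases eq_or_ne z w with rfl | hzw
  · simp [gaussKernel]
  have hd : z - w ≠ 0 := sub_ne_zero.2 hzw
  rw [setIntegral_mul_exp_neg_mul hS (by positivity), gaussKernel]
  have hn := Complex.mul_conj' (z - w)
  have hc : conj (z - w) ≠ 0 := (map_ne_zero _).2 hd
  set c := conj (z - w)
  set d := z - w
  generalize 1 - (1 + S * ‖d‖ ^ 2) * Real.exp (-S * ‖d‖ ^ 2) = A
  have hA : ((A / (‖d‖ ^ 2) ^ 2 : ℝ) : ℂ) = A / (d * c) ^ 2 := by
    rw [hn]; push_cast; rfl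
  rw [hA]
  field_simp

lemma integral_gaussFeature_mul_conj_scale (z w : ℂ) {S : ℝ} (hS : 0 ≤ S) :
    ∫ ω, gaussFeature z ω * conj (gaussFeature w ω) ∂(scaleMeasure S)
      = ((π / 16 * (S * Real.exp (-S * ‖z - w‖ ^ 2)) : ℝ) : ℂ) := by
  have hi := integrable_gaussFeature_mul_conj z w hS
  rw [scaleMeasure] at hi ⊢
  rw [integral_prod _ hi, setIntegral_congr_fun measurableSet_Ioc
    (fun s hs => integral_gaussFeature_mul_conj z w hs.1), integral_complex_ofReal,
    integral_const_mul, setIntegral_one_sub_mul_exp_neg_mul _ hS]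

end ScaleIntegrals

section KernelBound

open ComplexConjugate

lemma integrable_and_integral_mul_gaussian_sub {g : ℂ → ℝ} (hg : Integrable g) {S : ℝ}
    (hS : 0 < S) :
    Integrable (fun p : ℂ × ℂ => g p.1 * (S * Real.exp (-S * ‖p.1 - p.2‖ ^ 2))) ∧
    ∫ p : ℂ × ℂ, g p.1 * (S * Real.exp (-S * ‖p.1 - p.2‖ ^ 2)) = π * ∫ a, g a := by
  have h := (hg.convolution_integrand (ContinuousLinearMap.mul ℝ ℝ)
    ((integrable_gaussian_plane hS).const_mul S)).swap
  have hi : Integrable (fun p : ℂ × ℂ => g p.1 * (S * Real.exp (-S * ‖p.1 - p.2‖ ^ 2))) := by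
    refine h.congr (.of_forall fun p => ?_)
    simp [norm_sub_rev p.1 p.2]
  refine ⟨hi, ?_⟩
  rw [Measure.volume_eq_prod] at hi ⊢
  rw [integral_prod _ hi]
  have : ∀ a : ℂ, ∫ b : ℂ, g a * (S * Real.exp (-S * ‖a - b‖ ^ 2)) = π * g a := by
    intro a
    rw [integral_const_mul, integral_const_mul, integral_sub_left_eq_self
      (fun v : ℂ => Real.exp (-S * ‖v‖ ^ 2)) volume a, integral_gaussian_plane hS]
    field_simp
  simp only [this, integral_const_mul]

lemma integrable_and_integral_norm_superposition_sq_le {f : ℂ → ℂ} (hf : Integrable f)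
    (hf2 : Integrable (fun a => ‖f a‖ ^ 2)) {S : ℝ} (hS : 0 < S) :
    Integrable (fun ω => ‖∫ a, f a * gaussFeature a ω‖ ^ 2) (scaleMeasure S) ∧
    ∫ ω, ‖∫ a, f a * gaussFeature a ω‖ ^ 2 ∂(scaleMeasure S) ≤ π ^ 2 / 16 * ∫ a, ‖f a‖ ^ 2 := by
  obtain ⟨h1, h2⟩ := integrable_and_integral_superposition_mul (μ := volume)
    (ν := scaleMeasure S) (φ := gaussFeature) (ψ := fun b ω => conj (gaussFeature b ω))
    (M := S * (π / 16)) measurable_gaussFeature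
    (Complex.continuous_conj.measurable.comp measurable_gaussFeature)
    (fun a => (integrable_and_integral_norm_gaussFeature_sq a hS.le).1)
    (fun a => (integrable_and_integral_norm_gaussFeature_sq a hS.le).2.le)
    (fun a => by simpa using (integrable_and_integral_norm_gaussFeature_sq a hS.le).1)
    (fun a => by simpa using (integrable_and_integral_norm_gaussFeature_sq a hS.le).2.le)
    hf (Complex.conjLIE.toContinuousLinearEquiv.toContinuousLinearMap.integrable_comp hf)
  have hsq : ∀ ω, (∫ a, f a * gaussFeature a ω) * (∫ b, conj (f b) * conj (gaussFeature b ω))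
      = ((‖∫ a, f a * gaussFeature a ω‖ ^ 2 : ℝ) : ℂ) := by
    intro ω
    simp only [← map_mul]
    rw [integral_conj, Complex.mul_conj']
    simp
  have h1' : Integrable (fun ω => ((‖∫ a, f a * gaussFeature a ω‖ ^ 2 : ℝ) : ℂ))
      (scaleMeasure S) := h1.congr (.of_forall hsq)
  have h2' := (integral_congr_ae (.of_forall hsq)).symm.trans h2
  refine ⟨h1'.re, ?_⟩
  rw [integral_complex_ofReal] at h2'
  have h0 : 0 ≤ ∫ ω, ‖∫ a, f a * gaussFeature a ω‖ ^ 2 ∂(scaleMeasure S) :=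
    integral_nonneg fun ω => by positivity
  rw [← Real.norm_of_nonneg h0, ← Complex.norm_real, h2']
  obtain ⟨g1, e1⟩ := integrable_and_integral_mul_gaussian_sub hf2 hS
  have g2 : Integrable (fun p : ℂ × ℂ => ‖f p.2‖ ^ 2 * (S * Real.exp (-S * ‖p.1 - p.2‖ ^ 2))) :=
    g1.swap.congr (.of_forall fun p => by simp [norm_sub_rev p.1 p.2])
  have e2 : ∫ p : ℂ × ℂ, ‖f p.2‖ ^ 2 * (S * Real.exp (-S * ‖p.1 - p.2‖ ^ 2))
      = π * ∫ a, ‖f a‖ ^ 2 := by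
    rw [← e1, Measure.volume_eq_prod, ← integral_prod_swap]
    simp [norm_sub_rev]
  have e3 : π ^ 2 / 16 * ∫ a, ‖f a‖ ^ 2
      = ∫ p : ℂ × ℂ, π / 32 * (‖f p.1‖ ^ 2 * (S * Real.exp (-S * ‖p.1 - p.2‖ ^ 2))
        + ‖f p.2‖ ^ 2 * (S * Real.exp (-S * ‖p.1 - p.2‖ ^ 2))) := by
    rw [integral_const_mul, integral_add g1 g2, e1, e2]
    ring
  rw [e3, ← Measure.volume_eq_prod]
  refine norm_integral_le_of_norm_le ((g1.add g2).const_mul _) (.of_forall fun p => ?_)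
  rw [integral_gaussFeature_mul_conj_scale _ _ hS.le]
  have hE : 0 ≤ S * Real.exp (-S * ‖p.1 - p.2‖ ^ 2) := by positivity
  generalize S * Real.exp (-S * ‖p.1 - p.2‖ ^ 2) = E at hE
  rw [norm_mul, norm_mul, Complex.norm_real, Real.norm_of_nonneg (by positivity)]
  simp only [Complex.conjLIE_apply, LinearIsometryEquiv.coe_toContinuousLinearEquiv,
    ContinuousLinearEquiv.coe_coe, RCLike.norm_conj]
  have h3 : 0 ≤ π / 32 * E * (‖f p.1‖ - ‖f p.2‖) ^ 2 := by positivity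
  linarith

lemma norm_integral_mul_gaussKernel_le {f h : ℂ → ℂ} (hf : Integrable f)
    (hf2 : Integrable (fun a => ‖f a‖ ^ 2)) (hh : Integrable h)
    (hh2 : Integrable (fun a => ‖h a‖ ^ 2)) {S : ℝ} (hS : 0 < S) :
    ‖∫ p : ℂ × ℂ, f p.1 * h p.2 * gaussKernel S (p.1 - p.2)‖
      ≤ π / 2 * ((∫ a, ‖f a‖ ^ 2) + ∫ a, ‖h a‖ ^ 2) := by
  have h2 := (integrable_and_integral_superposition_mul (μ := volume)
    (ν := scaleMeasure S) (φ := gaussFeature) (ψ := gaussFeature)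
    (M := S * (π / 16)) measurable_gaussFeature measurable_gaussFeature
    (fun a => (integrable_and_integral_norm_gaussFeature_sq a hS.le).1)
    (fun a => (integrable_and_integral_norm_gaussFeature_sq a hS.le).2.le)
    (fun a => (integrable_and_integral_norm_gaussFeature_sq a hS.le).1)
    (fun a => (integrable_and_integral_norm_gaussFeature_sq a hS.le).2.le)
    hf hh).2
  obtain ⟨i1, l1⟩ := integrable_and_integral_norm_superposition_sq_le hf hf2 hS
  obtain ⟨i2, l2⟩ := integrable_and_integral_norm_superposition_sq_le hh hh2 hS
  have h3 : ∫ p : ℂ × ℂ, f p.1 * h p.2 *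
      ∫ ω, gaussFeature p.1 ω * gaussFeature p.2 ω ∂(scaleMeasure S)
      = -((π / 16 : ℝ) : ℂ) * ∫ p : ℂ × ℂ, f p.1 * h p.2 * gaussKernel S (p.1 - p.2) := by
    rw [← integral_const_mul]
    congr 1
    ext p
    rw [integral_gaussFeature_mul_eq_gaussKernel _ _ hS.le]
    ring
  rw [← Measure.volume_eq_prod, h3] at h2
  have h4 := (norm_integral_le_integral_norm _).trans (integral_norm_mul_le i1 i2)
  rw [h2, norm_mul, norm_neg, Complex.norm_real, Real.norm_of_nonneg (by positivity)] at h4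
  have hp := pi_pos
  have h5 : π / 16 * ‖∫ p : ℂ × ℂ, f p.1 * h p.2 * gaussKernel S (p.1 - p.2)‖
      ≤ π / 16 * (π / 2 * ((∫ a, ‖f a‖ ^ 2) + ∫ a, ‖h a‖ ^ 2)) := by
    refine h4.trans ?_
    linarith
  exact le_of_mul_le_mul_left h5 (by positivity)

end KernelBound

section DiscKernel

lemma norm_gaussKernel (S : ℝ) (hS : 0 ≤ S) (d : ℂ) :
    ‖gaussKernel S d‖
      = (1 - (1 + S * ‖d‖ ^ 2) * Real.exp (-(S * ‖d‖ ^ 2))) * (‖d‖ ^ 2)⁻¹ := by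
  have ht : 0 ≤ S * ‖d‖ ^ 2 := by positivity
  have h1 : (1 + S * ‖d‖ ^ 2) * Real.exp (-(S * ‖d‖ ^ 2)) ≤ 1 := by
    rw [Real.exp_neg, ← div_eq_mul_inv, div_le_one (Real.exp_pos _), add_comm]
    exact Real.add_one_le_exp _
  rw [gaussKernel, norm_mul, Complex.norm_real, norm_inv, norm_pow, neg_mul,
    Real.norm_of_nonneg (by linarith)]

lemma norm_gaussKernel_le (S : ℝ) (hS : 0 ≤ S) (d : ℂ) : ‖gaussKernel S d‖ ≤ S := by
  rw [norm_gaussKernel S hS]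
  rcases eq_or_ne d 0 with rfl | hd
  · simpa using hS
  have hd : 0 < ‖d‖ ^ 2 := by positivity
  have ht : 0 ≤ S * ‖d‖ ^ 2 := by positivity
  rw [← div_eq_mul_inv, div_le_iff₀ hd]
  generalize S * ‖d‖ ^ 2 = t at ht
  have h1 := Real.add_one_le_exp (-t)
  have h2 := Real.exp_pos (-t)
  nlinarith

lemma norm_gaussKernel_le_inv (S : ℝ) (hS : 0 ≤ S) (d : ℂ) :
    ‖gaussKernel S d‖ ≤ (‖d‖ ^ 2)⁻¹ := by
  rw [norm_gaussKernel S hS]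
  refine mul_le_of_le_one_left (by positivity) ?_
  have : 0 ≤ (1 + S * ‖d‖ ^ 2) * Real.exp (-(S * ‖d‖ ^ 2)) := by positivity
  linarith

lemma tendsto_gaussKernel {d : ℂ} (hd : d ≠ 0) :
    Filter.Tendsto (fun S => gaussKernel S d) Filter.atTop (nhds (d ^ 2)⁻¹) := by
  have hq : 0 < ‖d‖ ^ 2 := by positivity
  have h0 := Real.tendsto_pow_mul_exp_neg_atTop_nhds_zero 0
  have h1 := Real.tendsto_pow_mul_exp_neg_atTop_nhds_zero 1
  have ht : Filter.Tendsto (fun S : ℝ => S * ‖d‖ ^ 2) Filter.atTop Filter.atTop :=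
    Filter.tendsto_id.atTop_mul_const hq
  have h2 := (tendsto_const_nhds (x := (1 : ℝ))).sub ((h0.add h1).comp ht)
  have h3 := ((Complex.continuous_ofReal.tendsto _).comp h2).mul_const (d ^ 2)⁻¹
  simp only [add_zero, sub_zero, Complex.ofReal_one, one_mul] at h3
  refine h3.congr fun S => ?_
  simp only [gaussKernel, Function.comp_apply, pow_zero, pow_one, neg_mul]
  ring_nf

lemma measurable_gaussKernel (S : ℝ) : Measurable (gaussKernel S) := by
  unfold gaussKernel
  fun_prop

lemma integrable_mul_gaussKernel {f h : ℂ → ℂ} (hf : Integrable f) (hh : Integrable h) {S : ℝ}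
    (hS : 0 ≤ S) :
    Integrable (fun p : ℂ × ℂ => f p.1 * h p.2 * gaussKernel S (p.1 - p.2)) := by
  refine Integrable.mul_bdd (c := S) (hf.mul_prod hh) ?_
    (.of_forall fun p => norm_gaussKernel_le S hS _)
  exact ((measurable_gaussKernel S).comp (by fun_prop)).aestronglyMeasurable

lemma integrable_indicator_closedBall (a c : ℂ) (R : ℝ) :
    Integrable ((Metric.closedBall a R).indicator fun _ => c) :=
  (integrable_indicator_iff Metric.isClosed_closedBall.measurableSet).2
    (integrableOn_const (isCompact_closedBall a R).measure_lt_top.ne)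

lemma tendsto_integral_indicator_mul_gaussKernel {a b : ℂ} {R R' : ℝ} (hR : 0 ≤ R) (hR' : 0 ≤ R')
    (hab : R + R' < ‖a - b‖) (c c' : ℂ) :
    Filter.Tendsto (fun S => ∫ p : ℂ × ℂ, (Metric.closedBall a R).indicator (fun _ => c) p.1
      * (Metric.closedBall b R').indicator (fun _ => c') p.2 * gaussKernel S (p.1 - p.2))
      Filter.atTop (nhds (((π * R ^ 2 : ℝ) : ℂ) * c * (((π * R' ^ 2 : ℝ) : ℂ) * c')
        * ((a - b) ^ 2)⁻¹)) := by
  set u := (Metric.closedBall a R).indicator (fun _ => c) with hu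
  set v := (Metric.closedBall b R').indicator (fun _ => c') with hv
  have hbm : ∀ a R, MeasurableSet (Metric.closedBall (a : ℂ) R) :=
    fun a R => Metric.isClosed_closedBall.measurableSet
  have hui : Integrable u := integrable_indicator_closedBall a c R
  have hvi : Integrable v := integrable_indicator_closedBall b c' R'
  have huv := hui.mul_prod hvi
  set δ := ‖a - b‖ - (R + R') with hδ
  have hδ0 : 0 < δ := by linarith
  have hcase : ∀ p : ℂ × ℂ, u p.1 * v p.2 = 0 ∨ δ ≤ ‖p.1 - p.2‖ := by
    intro p
    by_cases h1 : p.1 ∈ Metric.closedBall a R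
    · by_cases h2 : p.2 ∈ Metric.closedBall b R'
      · right
        rw [mem_closedBall_iff_norm] at h1 h2
        have : a - b = (p.1 - p.2) - (p.1 - a) + (p.2 - b) := by ring
        have h3 : ‖a - b‖ ≤ ‖p.1 - p.2‖ + ‖p.1 - a‖ + ‖p.2 - b‖ := by
          rw [this]
          exact (norm_add_le _ _).trans (by gcongr; exact norm_sub_le _ _)
        linarith
      · left; simp [hv, h2]
    · left; simp [hu, h1]
  have hbound : ∀ k : ℂ, ∀ p : ℂ × ℂ, ‖k‖ ≤ (‖p.1 - p.2‖ ^ 2)⁻¹ →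
      ‖u p.1 * v p.2 * k‖ ≤ ‖u p.1 * v p.2‖ * (δ ^ 2)⁻¹ := by
    intro k p hk
    rcases hcase p with h | h
    · simp [h]
    · rw [norm_mul]
      gcongr
      refine hk.trans ?_
      gcongr
  have hlim : Integrable (fun p : ℂ × ℂ => u p.1 * v p.2 * ((p.1 - p.2) ^ 2)⁻¹) :=
    (huv.norm.mul_const (δ ^ 2)⁻¹).mono'
      (huv.aestronglyMeasurable.mul (Measurable.aestronglyMeasurable (by fun_prop)))
      (.of_forall fun p => hbound _ p (by simp))
  have hval : ∫ p : ℂ × ℂ, u p.1 * v p.2 * ((p.1 - p.2) ^ 2)⁻¹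
      = ((π * R ^ 2 : ℝ) : ℂ) * c * (((π * R' ^ 2 : ℝ) : ℂ) * c') * ((a - b) ^ 2)⁻¹ := by
    rw [Measure.volume_eq_prod] at hlim ⊢
    rw [integral_prod _ hlim]
    have hin : ∀ x, ∫ y, u x * v y * ((x - y) ^ 2)⁻¹
        = (Metric.closedBall a R).indicator
          (fun x => c * (((π * R' ^ 2 : ℝ) : ℂ) * c') * ((x - b) ^ 2)⁻¹) x := by
      intro x
      by_cases hx : x ∈ Metric.closedBall a R
      · have : ∀ y, u x * v y * ((x - y) ^ 2)⁻¹
            = (Metric.closedBall b R').indicator (fun y => c * c' * ((y - x) ^ 2)⁻¹) y := by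
          intro y
          by_cases hy : y ∈ Metric.closedBall b R'
          · simp [hu, hv, hx, hy, sub_sq_comm x y]
          · simp [hv, hy]
        simp only [this]
        have hxb : R' < ‖b - x‖ := by
          rw [mem_closedBall_iff_norm] at hx
          have h3 : ‖a - b‖ ≤ ‖x - a‖ + ‖b - x‖ := by
            rw [← norm_neg (a - b), show -(a - b) = (x - a) + (b - x) by ring]
            exact norm_add_le _ _
          linarith
        rw [integral_indicator (hbm _ _), integral_const_mul, setIntegral_inv_sub_sq hR' hxb,
          Set.indicator_of_mem hx, sub_sq_comm b x]
        ring
      · simp [hu, hx]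
    simp only [hin]
    rw [integral_indicator (hbm _ _), integral_const_mul,
      setIntegral_inv_sub_sq hR (by linarith)]
    ring
  rw [← hval]
  refine tendsto_integral_filter_of_dominated_convergence
    (fun p => ‖u p.1 * v p.2‖ * (δ ^ 2)⁻¹) ?_ ?_ (huv.norm.mul_const _) ?_
  · filter_upwards [Filter.eventually_ge_atTop 0] with S hS
    exact (integrable_mul_gaussKernel hui hvi hS).aestronglyMeasurable
  · filter_upwards [Filter.eventually_ge_atTop 0] with S hS
    exact .of_forall fun p => hbound _ p (norm_gaussKernel_le_inv S hS _)
  · refine .of_forall fun p => ?_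
    rcases hcase p with h | h
    · simp [h]
    · exact (tendsto_gaussKernel (norm_pos_iff.1 (hδ0.trans_le h))).const_mul _

end DiscKernel

section DiscSums

variable {ι : Type*} [Fintype ι]

lemma norm_sum_indicator_sq {D : ι → Set ℂ} (hD : Pairwise fun i j => Disjoint (D i) (D j))
    (c : ι → ℂ) (x : ℂ) :
    ‖∑ i, (D i).indicator (fun _ => c i) x‖ ^ 2
      = ∑ i, (D i).indicator (fun _ => ‖c i‖ ^ 2) x := by
  by_cases h : ∃ i, x ∈ D i
  · obtain ⟨i, hi⟩ := h
    have hj : ∀ j, j ≠ i → x ∉ D j := fun j hj hx => Set.disjoint_left.1 (hD hj) hx hi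
    rw [Finset.sum_eq_single_of_mem i (Finset.mem_univ _) (fun j _ h => by simp [hj j h]),
      Finset.sum_eq_single_of_mem i (Finset.mem_univ _) (fun j _ h => by simp [hj j h])]
    simp [hi]
  · push Not at h
    simp [h]

lemma volume_real_closedBall_complex (a : ℂ) {R : ℝ} (hR : 0 ≤ R) :
    volume.real (Metric.closedBall a R) = π * R ^ 2 := by
  rw [Measure.real, Complex.volume_closedBall]
  simp [hR, mul_comm]

lemma integral_norm_sum_indicator_sq {a : ι → ℂ} {R : ι → ℝ} (hR : ∀ i, 0 ≤ R i)
    (hD : Pairwise fun i j => R i + R j < ‖a i - a j‖) (c : ι → ℂ) :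
    Integrable (fun x => ‖∑ i, (Metric.closedBall (a i) (R i)).indicator (fun _ => c i) x‖ ^ 2) ∧
    ∫ x, ‖∑ i, (Metric.closedBall (a i) (R i)).indicator (fun _ => c i) x‖ ^ 2
      = ∑ i, π * R i ^ 2 * ‖c i‖ ^ 2 := by
  have hd : Pairwise fun i j =>
      Disjoint (Metric.closedBall (a i) (R i)) (Metric.closedBall (a j) (R j)) := fun i j hij =>
    Metric.closedBall_disjoint_closedBall (by rw [dist_eq_norm]; exact hD hij)
  have hm : ∀ i, MeasurableSet (Metric.closedBall (a i) (R i)) := fun i =>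
    Metric.isClosed_closedBall.measurableSet
  have hi : ∀ i, Integrable ((Metric.closedBall (a i) (R i)).indicator fun _ => ‖c i‖ ^ 2) :=
    fun i => (integrable_indicator_iff (hm i)).2
      (integrableOn_const (isCompact_closedBall _ _).measure_lt_top.ne)
  simp only [norm_sum_indicator_sq hd]
  refine ⟨integrable_finsetSum _ fun i _ => hi i, ?_⟩
  rw [integral_finsetSum _ fun i _ => hi i]
  refine Finset.sum_congr rfl fun i _ => ?_
  rw [integral_indicator (hm i), setIntegral_const, volume_real_closedBall_complex _ (hR i),
    smul_eq_mul]

lemma integral_sum_mul_sum_gaussKernel {u v : ι → ℂ → ℂ} (hu : ∀ i, Integrable (u i))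
    (hv : ∀ i, Integrable (v i)) {S : ℝ} (hS : 0 ≤ S) :
    ∫ p : ℂ × ℂ, (∑ i, u i p.1) * (∑ j, v j p.2) * gaussKernel S (p.1 - p.2)
      = ∑ i, ∑ j, ∫ p : ℂ × ℂ, u i p.1 * v j p.2 * gaussKernel S (p.1 - p.2) := by
  have h : ∀ i j, Integrable fun p : ℂ × ℂ => u i p.1 * v j p.2 * gaussKernel S (p.1 - p.2) :=
    fun i j => integrable_mul_gaussKernel (hu i) (hv j) hS
  simp only [Finset.sum_mul_sum, Finset.sum_mul _ _ (gaussKernel S _)]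
  rw [integral_finsetSum _ fun i _ => integrable_finsetSum _ fun j _ => h i j]
  exact Finset.sum_congr rfl fun i _ => integral_finsetSum _ fun j _ => h i j

/-- Discrete form of the `L²` bound for the Beurling transform, for charges carried by
separated discs. -/
lemma norm_sum_offDiag_inv_sub_sq_le [DecidableEq ι] {a b p : ι → ℂ} {R : ι → ℝ}
    (hR : ∀ i, 0 < R i) (ha : Pairwise fun i j => R i + R j < ‖a i - a j‖)
    (hb : Pairwise fun i j => R i + R j < ‖b i - b j‖)
    (hab : Pairwise fun i j => R i + R j < ‖a i - b j‖) :
    ‖∑ i, ∑ j, if i = j then 0 else p i * p j * ((a i - b j) ^ 2)⁻¹‖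
      ≤ 2 * ∑ i, ‖p i‖ ^ 2 / R i ^ 2 := by
  set c : ι → ℂ := fun i => p i / ((π * R i ^ 2 : ℝ) : ℂ) with hc
  set u : ι → ℂ → ℂ := fun i => (Metric.closedBall (a i) (R i)).indicator (fun _ => c i) with hu
  set v : ι → ℂ → ℂ := fun i => (Metric.closedBall (b i) (R i)).indicator (fun _ => c i) with hv
  have hui : ∀ i, Integrable (u i) := fun i => integrable_indicator_closedBall _ _ _
  have hvi : ∀ i, Integrable (v i) := fun i => integrable_indicator_closedBall _ _ _
  have hcp : ∀ i, ((π * R i ^ 2 : ℝ) : ℂ) * c i = p i := fun i => by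
    have hi := hR i
    have : ((π * R i ^ 2 : ℝ) : ℂ) ≠ 0 := by exact_mod_cast (by positivity : π * R i ^ 2 ≠ 0)
    simp only [hc]
    field_simp
  have hcn : ∀ i, π * (π * R i ^ 2 * ‖c i‖ ^ 2) = ‖p i‖ ^ 2 / R i ^ 2 := fun i => by
    have hi := hR i
    rw [← hcp i, norm_mul, Complex.norm_real, Real.norm_of_nonneg (by positivity)]
    field_simp
  set T : ℝ → ι → ι → ℂ := fun S i j =>
    ∫ q : ℂ × ℂ, u i q.1 * v j q.2 * gaussKernel S (q.1 - q.2) with hT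
  have hsq : ∀ (d : ι → ℂ) i,
      Integrable (fun x => ‖(Metric.closedBall (d i) (R i)).indicator (fun _ => c i) x‖ ^ 2) ∧
      ∫ x, ‖(Metric.closedBall (d i) (R i)).indicator (fun _ => c i) x‖ ^ 2
        = π * R i ^ 2 * ‖c i‖ ^ 2 := fun d i => by
    simpa using integral_norm_sum_indicator_sq (ι := Unit) (a := fun _ => d i)
      (R := fun _ => R i) (fun _ => (hR i).le) (fun _ _ h => (h rfl).elim) (fun _ => c i)
  obtain ⟨fa, ea⟩ := integral_norm_sum_indicator_sq (fun i => (hR i).le) ha c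
  obtain ⟨fb, eb⟩ := integral_norm_sum_indicator_sq (fun i => (hR i).le) hb c
  have hbound : ∀ S, 0 < S →
      ‖∑ i, ∑ j, if i = j then 0 else T S i j‖ ≤ 2 * ∑ i, ‖p i‖ ^ 2 / R i ^ 2 := by
    intro S hS
    have hall : ‖∑ i, ∑ j, T S i j‖ ≤ ∑ i, ‖p i‖ ^ 2 / R i ^ 2 := by
      rw [← integral_sum_mul_sum_gaussKernel hui hvi hS.le]
      refine (norm_integral_mul_gaussKernel_le (integrable_finsetSum _ fun i _ => hui i) fa
        (integrable_finsetSum _ fun i _ => hvi i) fb hS).trans (le_of_eq ?_)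
      simp only [hu, hv, ea, eb, ← hcn, ← Finset.mul_sum]
      ring
    have hdiag : ∀ i, ‖T S i i‖ ≤ ‖p i‖ ^ 2 / R i ^ 2 := fun i => by
      refine (norm_integral_mul_gaussKernel_le (hui i) (hsq a i).1 (hvi i) (hsq b i).1
        hS).trans (le_of_eq ?_)
      simp only [hu, hv, (hsq a i).2, (hsq b i).2, ← hcn]
      ring
    have hsplit : ∑ i, ∑ j, (if i = j then 0 else T S i j)
        = (∑ i, ∑ j, T S i j) - ∑ i, T S i i := by
      rw [← Finset.sum_sub_distrib]
      refine Finset.sum_congr rfl fun i _ => ?_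
      have h1 : T S i i = ∑ j, if i = j then T S i j else 0 := by simp
      rw [h1, ← Finset.sum_sub_distrib]
      exact Finset.sum_congr rfl fun j _ => by split_ifs <;> simp
    rw [hsplit, two_mul]
    refine (norm_sub_le _ _).trans (add_le_add hall ?_)
    exact (norm_sum_le _ _).trans (Finset.sum_le_sum fun i _ => hdiag i)
  have hlim : Filter.Tendsto (fun S => ∑ i, ∑ j, if i = j then 0 else T S i j) Filter.atTop
      (nhds (∑ i, ∑ j, if i = j then 0 else p i * p j * ((a i - b j) ^ 2)⁻¹)) := by
    refine tendsto_finsetSum _ fun i _ => tendsto_finsetSum _ fun j _ => ?_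
    split_ifs with hij
    · exact tendsto_const_nhds
    · have h := tendsto_integral_indicator_mul_gaussKernel (hR i).le (hR j).le (hab hij)
        (c i) (c j)
      rwa [hcp, hcp] at h
  refine le_of_tendsto hlim.norm ?_
  filter_upwards [Filter.eventually_gt_atTop 0] with S hS
  exact hbound S hS

end DiscSums

section MixedDifference

lemma hasDerivAt_log_norm_add_mul_sub {z w p : ℂ} {s : ℝ} (h : z + s * p - w ≠ 0) :
    HasDerivAt (fun s : ℝ => Real.log ‖z + s * p - w‖) (p / (z + s * p - w)).re s := by
  have h1 : HasDerivAt (fun s : ℝ => z + s * p - w) p s := by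
    simpa using (((hasDerivAt_id s).ofReal_comp.mul_const p).const_add z).sub_const w
  have h2 := (h1.norm_sq.log (by positivity)).div_const 2
  refine (h2.congr_deriv ?_).congr_of_eventuallyEq (.of_forall fun s => ?_)
  · rw [Complex.div_re, Complex.inner, ← Complex.normSq_eq_norm_sq, Complex.mul_re,
      Complex.conj_re, Complex.conj_im]
    field_simp
    ring
  · simp [Real.log_pow]

lemma hasDerivAt_re_div_sub_add_mul {z w p q : ℂ} {t : ℝ} (h : z - (w + t * q) ≠ 0) :
    HasDerivAt (fun t : ℝ => (p / (z - (w + t * q))).re)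
      (p * q * ((z - (w + t * q)) ^ 2)⁻¹).re t := by
  have h1 : HasDerivAt (fun t : ℝ => z - (w + t * q)) (-q) t := by
    simpa using (((hasDerivAt_id t).ofReal_comp.mul_const q).const_add w).const_sub z
  have h2 := Complex.reCLM.hasFDerivAt.comp_hasDerivAt t
    (((h1.inv h).const_mul p))
  refine (h2.congr_deriv ?_).congr_of_eventuallyEq (.of_forall fun s => ?_)
  · simp only [Complex.reCLM_apply]
    congr 1
    field_simp
  · simp [div_eq_mul_inv]

variable {ι : Type*} [Fintype ι] [DecidableEq ι]

/-- Sum of the off-diagonal logarithmic interactions of two partially transported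
configurations. -/
def logSum (x p : ι → ℂ) (s t : ℝ) : ℝ :=
  ∑ i, ∑ j, if i = j then 0 else Real.log ‖x i + s * p i - (x j + t * p j)‖

lemma logSum_swap (x p : ι → ℂ) (s t : ℝ) : logSum x p s t = logSum x p t s := by
  rw [logSum, Finset.sum_comm, logSum]
  refine Finset.sum_congr rfl fun i _ => Finset.sum_congr rfl fun j _ => ?_
  simp only [eq_comm (a := j), norm_sub_rev (x j + _)]

lemma exists_logSum_mixed_difference_eq {x p : ι → ℂ}
    (h : ∀ i j, i ≠ j → ∀ s ∈ Set.Icc (0 : ℝ) 1, ∀ t ∈ Set.Icc (0 : ℝ) 1,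
      x i + s * p i - (x j + t * p j) ≠ 0) :
    ∃ s ∈ Set.Icc (0 : ℝ) 1, ∃ t ∈ Set.Icc (0 : ℝ) 1,
      logSum x p 1 1 - logSum x p 1 0 - (logSum x p 0 1 - logSum x p 0 0)
        = (∑ i, ∑ j, if i = j then 0
            else p i * p j * ((x i + s * p i - (x j + t * p j)) ^ 2)⁻¹).re := by
  set D : ℝ → ℝ → ℝ := fun s t => ∑ i, ∑ j, if i = j then 0
    else (p i / (x i + s * p i - (x j + t * p j))).re with hD
  have hs : ∀ t ∈ Set.Icc (0 : ℝ) 1, ∀ s ∈ Set.Icc (0 : ℝ) 1,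
      HasDerivAt (fun s => logSum x p s t) (D s t) s := by
    intro t ht s hs
    unfold logSum
    refine HasDerivAt.fun_sum fun i _ => HasDerivAt.fun_sum fun j _ => ?_
    split_ifs with hij
    · exact hasDerivAt_const _ _
    · exact hasDerivAt_log_norm_add_mul_sub (h i j hij s hs t ht)
  have ht : ∀ s ∈ Set.Icc (0 : ℝ) 1, ∀ t ∈ Set.Icc (0 : ℝ) 1,
      HasDerivAt (fun t => D s t) (∑ i, ∑ j, if i = j then (0 : ℂ)
        else p i * p j * ((x i + s * p i - (x j + t * p j)) ^ 2)⁻¹).re t := by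
    intro s hs t ht
    simp only [Complex.re_sum, hD]
    refine HasDerivAt.fun_sum fun i _ => HasDerivAt.fun_sum fun j _ => ?_
    split_ifs with hij
    · simpa using hasDerivAt_const t (0 : ℝ)
    · exact hasDerivAt_re_div_sub_add_mul (h i j hij s hs t ht)
  have h0 : (0 : ℝ) ∈ Set.Icc (0 : ℝ) 1 := by simp
  have h1 : (1 : ℝ) ∈ Set.Icc (0 : ℝ) 1 := by simp
  obtain ⟨s, hsm, es⟩ := exists_hasDerivAt_eq_slope (fun s => logSum x p s 1 - logSum x p s 0)
    (fun s => D s 1 - D s 0) one_pos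
    (fun s hm => ((hs 1 h1 s hm).sub (hs 0 h0 s hm)).continuousAt.continuousWithinAt)
    (fun s hm => (hs 1 h1 s (Set.Ioo_subset_Icc_self hm)).sub
      (hs 0 h0 s (Set.Ioo_subset_Icc_self hm)))
  have hsI := Set.Ioo_subset_Icc_self hsm
  obtain ⟨t, htm, et⟩ := exists_hasDerivAt_eq_slope (fun t => D s t) _ one_pos
    (fun t hm => (ht s hsI t hm).continuousAt.continuousWithinAt)
    (fun t hm => ht s hsI t (Set.Ioo_subset_Icc_self hm))
  refine ⟨s, hsI, t, Set.Ioo_subset_Icc_self htm, ?_⟩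
  rw [et, sub_zero, div_one, es]
  ring

/-- The interaction between the displacement dipoles is controlled by the squared relative
displacements. -/
lemma abs_logSum_mixed_difference_le {x p : ι → ℂ} {r : ι → ℝ} (hr : ∀ i, 0 < r i)
    (hx : ∀ i j, i ≠ j → r i + r j ≤ ‖x i - x j‖) (hp : ∀ i, ‖p i‖ ≤ r i / 2) :
    |logSum x p 1 1 - logSum x p 1 0 - (logSum x p 0 1 - logSum x p 0 0)|
      ≤ 32 * ∑ i, ‖p i‖ ^ 2 / r i ^ 2 := by
  have hsep : ∀ i j, i ≠ j → ∀ s ∈ Set.Icc (0 : ℝ) 1, ∀ t ∈ Set.Icc (0 : ℝ) 1,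
      r i / 4 + r j / 4 < ‖x i + s * p i - (x j + t * p j)‖ := by
    intro i j hij s hs t ht
    have hsm : ∀ k, ∀ s ∈ Set.Icc (0 : ℝ) 1, ‖(s : ℂ) * p k‖ ≤ r k / 2 := fun k s hs => by
      rw [norm_mul, Complex.norm_real, Real.norm_of_nonneg hs.1]
      exact (mul_le_of_le_one_left (norm_nonneg _) hs.2).trans (hp k)
    have h1 : ‖x i - x j‖
        ≤ ‖x i + s * p i - (x j + t * p j)‖ + ‖(s : ℂ) * p i‖ + ‖(t : ℂ) * p j‖ := by
      rw [show x i - x j = (x i + s * p i - (x j + t * p j)) - s * p i + t * p j by ring]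
      exact (norm_add_le _ _).trans (by gcongr; exact norm_sub_le _ _)
    linarith [hsm i s hs, hsm j t ht, hx i j hij, hr i, hr j]
  obtain ⟨s, hs, t, ht, e⟩ := exists_logSum_mixed_difference_eq (x := x) (p := p)
    (fun i j hij s hs t ht => by
      have := hsep i j hij s hs t ht
      exact norm_pos_iff.1 (by linarith [hr i, hr j]))
  rw [e]
  have h := norm_sum_offDiag_inv_sub_sq_le (a := fun i => x i + s * p i)
    (b := fun i => x i + t * p i) (p := p) (R := fun i => r i / 4)
    (fun i => by linarith [hr i]) (fun i j hij => hsep i j hij s hs s hs)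
    (fun i j hij => hsep i j hij t ht t ht) (fun i j hij => hsep i j hij s hs t ht)
  refine (Complex.abs_re_le_norm _).trans (h.trans (le_of_eq ?_))
  rw [Finset.mul_sum, Finset.mul_sum]
  refine Finset.sum_congr rfl fun i _ => ?_
  have := hr i
  field_simp
  ring

end MixedDifference

lemma rmin_add_rmin_le_dist {N : ℕ} (X : Fin N → E2) {i j : Fin N} (hij : i ≠ j) :
    rmin X i + rmin X j ≤ dist (X i) (X j) := by
  have h : ∀ i j : Fin N, j ≠ i → 2 * rmin X i ≤ dist (X j) (X i) := fun i j hji => by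
    rw [rmin, ← mul_assoc, mul_one_div_cancel two_ne_zero, one_mul]
    exact ciInf_le (Set.finite_range fun j : {j : Fin N // j ≠ i} => dist (X j.1) (X i)).bddBelow
      ⟨j, hji⟩
  have h1 := h i j hij.symm
  have h2 := h j i hij
  rw [dist_comm] at h1
  linarith

/-- The energy splits into the dipole self-energies and a mixed difference of logarithmic
interactions. -/
lemma Flam_eq {N : ℕ} {X Y : Fin N → E2} {lam : ℝ} (hlam : 0 < lam)
    (hXX : ∀ i j, i ≠ j → 2 * lam ≤ ‖X i - X j‖) (hYY : ∀ i j, i ≠ j → 2 * lam ≤ ‖Y i - Y j‖)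
    (hXY : ∀ i j, i ≠ j → 2 * lam ≤ ‖X i - Y j‖) :
    let x : Fin N → ℂ := fun i => planeIso (X i)
    let p : Fin N → ℂ := fun i => planeIso (Y i) - planeIso (X i)
    Flam N lam X Y = -(∑ i, gsm lam (X i - Y i))
      - (1 / 2) * (logSum x p 1 1 - logSum x p 1 0 - (logSum x p 0 1 - logSum x p 0 0)) := by
  intro x p
  have hterm : ∀ i j,
      gsm lam (X i - X j) + gsm lam (Y i - Y j) - 2 * gsm lam (X i - Y j)
        = (2 * (if i = j then 0 else Real.log ‖x i + (0 : ℝ) * p i - (x j + (1 : ℝ) * p j)‖)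
          - (if i = j then 0 else Real.log ‖x i + (0 : ℝ) * p i - (x j + (0 : ℝ) * p j)‖)
          - (if i = j then 0 else Real.log ‖x i + (1 : ℝ) * p i - (x j + (1 : ℝ) * p j)‖))
          + if i = j then 2 * (-Real.log lam + kappa) - 2 * gsm lam (X i - Y j) else 0 := by
    intro i j
    split_ifs with hij
    · subst hij
      rw [sub_self, sub_self, gsm_zero hlam]
      ring
    · rw [gsm_eq_neg_log hlam (hXX i j hij), gsm_eq_neg_log hlam (hYY i j hij),
        gsm_eq_neg_log hlam (hXY i j hij), ← planeIso.norm_map (X i - X j),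
        ← planeIso.norm_map (Y i - Y j), ← planeIso.norm_map (X i - Y j)]
      simp only [map_sub, x, p]
      simp
      ring
  rw [Flam, logSum_swap x p 1 0]
  simp only [hterm, Finset.sum_add_distrib, Finset.sum_sub_distrib, ← Finset.mul_sum]
  simp only [logSum, Finset.sum_ite_eq, Finset.mem_univ, if_true, Finset.sum_sub_distrib,
    ← Finset.mul_sum, Finset.sum_const, Finset.card_univ, Fintype.card_fin, nsmul_eq_mul]
  ring

/-- Upper bound on the energy of well-separated dipole configurations
(equation (4.7)). -/
theorem statement19 :
    ∃ C : ℝ, 0 < C ∧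
      ∀ N : ℕ, 1 ≤ N → ∀ X Y : Fin N → E2, Function.Injective X →
        ∀ lam : ℝ, 0 < lam → (∀ i, lam ≤ rmin X i / 4) →
        (∀ i, dist (Y i) (X i) ≤ rmin X i / 2) →
        Flam N lam X Y ≤
          -(∑ i : Fin N, gsm lam (X i - Y i)) +
            C * ∑ i : Fin N, dist (X i) (Y i) ^ 2 / rmin X i ^ 2 := by
  refine ⟨16, by norm_num, fun N _ X Y _ lam hlam hr hp => ?_⟩
  have hr0 : ∀ i, 0 < rmin X i := fun i => by linarith [hr i]
  have hXX : ∀ i j, i ≠ j → rmin X i + rmin X j ≤ ‖X i - X j‖ := fun i j hij => by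
    rw [← dist_eq_norm]
    exact rmin_add_rmin_le_dist X hij
  have hXY : ∀ i j, i ≠ j → rmin X i / 2 + rmin X j / 2 ≤ ‖X i - Y j‖ := fun i j hij => by
    have h1 := dist_triangle (X i) (Y j) (X j)
    have h2 := hXX i j hij
    rw [← dist_eq_norm] at h2 ⊢
    linarith [hp j, hr0 i]
  have hYY : ∀ i j, i ≠ j → rmin X i / 2 + rmin X j / 2 ≤ ‖Y i - Y j‖ := fun i j hij => by
    have h1 := dist_triangle4 (X i) (Y i) (Y j) (X j)
    have h2 := hXX i j hij
    rw [← dist_eq_norm] at h2 ⊢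
    linarith [hp j, hp i, dist_comm (X i) (Y i)]
  rw [Flam_eq hlam (fun i j hij => by linarith [hXX i j hij, hr i, hr j])
    (fun i j hij => by linarith [hYY i j hij, hr i, hr j])
    (fun i j hij => by linarith [hXY i j hij, hr i, hr j])]
  have hn : ∀ i, ‖planeIso (Y i) - planeIso (X i)‖ = dist (X i) (Y i) := fun i => by
    rw [← map_sub, planeIso.norm_map, ← dist_eq_norm, dist_comm]
  have h := abs_logSum_mixed_difference_le (x := fun i => planeIso (X i))
    (p := fun i => planeIso (Y i) - planeIso (X i)) (r := rmin X) hr0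
    (fun i j hij => by
      rw [← map_sub, planeIso.norm_map]
      exact hXX i j hij)
    (fun i => by
      rw [hn, dist_comm]
      exact hp i)
  simp only [hn] at h
  linarith [neg_abs_le (logSum (fun i => planeIso (X i))
    (fun i => planeIso (Y i) - planeIso (X i)) 1 1 - logSum (fun i => planeIso (X i))
    (fun i => planeIso (Y i) - planeIso (X i)) 1 0 - (logSum (fun i => planeIso (X i))
    (fun i => planeIso (Y i) - planeIso (X i)) 0 1 - logSum (fun i => planeIso (X i))
    (fun i => planeIso (Y i) - planeIso (X i)) 0 0))]
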